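/- arXiv:2404.05753 — 5 statements merged into one kernel-verified Lean document; each statement's English description precedes it below -/
import Mathlib

section
/- Let H be a real Hilbert space, C ⊆ H a closed convex set, k < 1, and T : C → C a k-demicontractive mapping. Then for any λ ∈ (0, 1 − k), the averaged mapping T_λ defined by T_λ x = (1 − λ)x + λ T x (which maps C into C since C is convex) is quasi-nonexpansive. -/
theorem norm_sub_smul_add_smul_sq {H : Type*} [NormedAddCommGroup H] [InnerProductSpace ℝ H]
    (u v : H) (t : ℝ) :
    ‖(1 - t) • u + t • v‖ ^ 2 =
      (1 - t) * ‖u‖ ^ 2 + t * ‖v‖ ^ 2 - t * (1 - t) * ‖u - v‖ ^ 2 := by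
  rw [norm_add_sq_real, norm_sub_sq_real, norm_smul, norm_smul, mul_pow, mul_pow,
    Real.norm_eq_abs, Real.norm_eq_abs, sq_abs, sq_abs, real_inner_smul_left,
    real_inner_smul_right]
  ring

/-- If `T : C → C` is `k`-demicontractive on a closed convex subset `C` of a real
Hilbert space, then for any `λ ∈ (0, 1 - k)` the averaged map
`T_λ x = (1 - λ) x + λ T x` is quasi-nonexpansive (its fixed points coincide with
those of `T`). -/
theorem stmt_0 {H : Type*} [NormedAddCommGroup H] [InnerProductSpace ℝ H] [CompleteSpace H]
    (C : Set H) (hCclosed : IsClosed C) (hCconv : Convex ℝ C)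
    (T : H → H) (hT : Set.MapsTo T C C)
    (k : ℝ) (hk : k < 1)
    (hfix : ∃ y ∈ C, T y = y)
    (hdemi : ∀ x ∈ C, ∀ y ∈ C, T y = y →
      ‖T x - y‖ ^ 2 ≤ ‖x - y‖ ^ 2 + k * ‖x - T x‖ ^ 2)
    (lam : ℝ) (hlam : lam ∈ Set.Ioo 0 (1 - k)) :
    ∀ x ∈ C, ∀ y ∈ C, (1 - lam) • y + lam • T y = y →
      ‖((1 - lam) • x + lam • T x) - y‖ ≤ ‖x - y‖ := by
  intro x hx y hy hxy
  obtain ⟨hpos, hlt⟩ := hlam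
  have hTy : T y = y := by
    have h : lam • (T y - y) = 0 := by
      linear_combination (norm := module) hxy
    exact sub_eq_zero.mp ((smul_eq_zero.mp h).resolve_left hpos.ne')
  have hconv := norm_sub_smul_add_smul_sq (x - y) (T x - y) lam
  rw [sub_sub_sub_cancel_right] at hconv
  have hsub : (1 - lam) • x + lam • T x - y = (1 - lam) • (x - y) + lam • (T x - y) := by
    module
  rw [hsub]
  refine (sq_le_sq₀ (norm_nonneg _) (norm_nonneg _)).mp ?_
  have hd := mul_le_mul_of_nonneg_left (hdemi x hx y hy hTy) hpos.le
  have hn : 0 ≤ lam * (1 - k - lam) * ‖x - T x‖ ^ 2 :=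
    mul_nonneg (mul_nonneg hpos.le (sub_nonneg.mpr hlt.le)) (sq_nonneg _)
  linarith
end

section
/- Let H be a real Hilbert space, C ⊆ H a convex set, k < 1, and T : C → C a k-demicontractive mapping. Then for any λ ∈ (0, 1], all x ∈ C and all y ∈ Fix(T): ‖T_λ x − y‖² ≤ ‖x − y‖² − λ(1 − k − λ)‖Tx − x‖², where T_λ x = (1 − λ)x + λ T x. -/
/-- If `T : C → C` is `k`-demicontractive on a convex subset `C` of a real Hilbert
space, then for any `λ ∈ (0, 1]`, all `x ∈ C` and `y ∈ Fix T`: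
`‖T_λ x − y‖² ≤ ‖x − y‖² − λ(1 − k − λ)‖Tx − x‖²`. -/
theorem stmt_1 {H : Type*} [NormedAddCommGroup H] [InnerProductSpace ℝ H] [CompleteSpace H]
    (C : Set H) (hCconv : Convex ℝ C)
    (T : H → H) (hT : Set.MapsTo T C C)
    (k : ℝ) (hk : k < 1)
    (hfix : ∃ y ∈ C, T y = y)
    (hdemi : ∀ x ∈ C, ∀ y ∈ C, T y = y →
      ‖T x - y‖ ^ 2 ≤ ‖x - y‖ ^ 2 + k * ‖x - T x‖ ^ 2)
    (lam : ℝ) (hlam : lam ∈ Set.Ioc 0 1) :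
    ∀ x ∈ C, ∀ y ∈ C, T y = y →
      ‖((1 - lam) • x + lam • T x) - y‖ ^ 2 ≤
        ‖x - y‖ ^ 2 - lam * (1 - k - lam) * ‖T x - x‖ ^ 2 := by
  intro x hx y hy hTy
  have h := hdemi x hx y hy hTy
  rw [norm_sub_rev x (T x), show T x - y = (x - y) + (T x - x) by abel, norm_add_sq_real] at h
  rw [show ((1 - lam) • x + lam • T x) - y = (x - y) + lam • (T x - x) by module,
    norm_add_sq_real, real_inner_smul_right, norm_smul, mul_pow, Real.norm_eq_abs, sq_abs]
  have := mul_le_mul_of_nonneg_left h hlam.1.le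
  linarith
end

section
/- Let C = [0, 1] ⊆ ℝ and T₅ : C → C defined by T₅x = 7/8 if 0 ≤ x < 1 and T₅1 = 1/4. Then for no k < 1 is T₅ k-strictly pseudocontractive: for every k < 1 there exist x, y ∈ [0, 1] with |T₅x − T₅y|² > |x − y|² + k|x − y − T₅x + T₅y|². -/
/-- `T₅` (with `T₅ x = 7/8` for `x < 1`, `T₅ 1 = 1/4`) on `[0, 1] ⊆ ℝ` is not
`k`-strictly pseudocontractive for any `k < 1`. -/
theorem stmt_15 (T : ℝ → ℝ)
    (hT : ∀ x, x < 1 → T x = 7 / 8) (hT1 : T 1 = 1 / 4) :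
    ∀ k : ℝ, k < 1 → ∃ x ∈ Set.Icc (0 : ℝ) 1, ∃ y ∈ Set.Icc (0 : ℝ) 1,
      |T x - T y| ^ 2 > |x - y| ^ 2 + k * |x - y - T x + T y| ^ 2 := by
  intro k hk
  rcases le_total k 0 with hk0 | hk0
  · refine ⟨7 / 8, by norm_num, 1, by norm_num, ?_⟩
    rw [hT (7 / 8) (by norm_num), hT1]
    simp only [sq_abs]
    linarith
  · refine ⟨1 - (1 - k) / 8, ⟨by linarith, by linarith⟩, 1, by norm_num, ?_⟩
    rw [hT (1 - (1 - k) / 8) (by linarith), hT1]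
    simp only [sq_abs]
    have hpos : 0 < (1 - k) * (25 - (1 + k) * (1 - k) - 10 * k) :=
      mul_pos (by linarith) (by nlinarith)
    linarith
end

section
/- Let H be a real Hilbert space, C ⊆ H a convex set, k < 1, and T : C → C a k-strictly pseudocontractive mapping. Then for any λ ∈ (0, 1 − k), the averaged mapping T_λ defined by T_λ x = (1 − λ)x + λ T x is nonexpansive. -/
/-- If `T : C → C` is `k`-strictly pseudocontractive on a convex subset of a real
Hilbert space, then for any `λ ∈ (0, 1 − k)` the averaged map
`T_λ x = (1 − λ) x + λ T x` is nonexpansive. -/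
theorem stmt_16 {H : Type*} [NormedAddCommGroup H] [InnerProductSpace ℝ H] [CompleteSpace H]
    (C : Set H) (hCconv : Convex ℝ C)
    (T : H → H) (hT : Set.MapsTo T C C)
    (k : ℝ) (hk : k < 1)
    (hspc : ∀ x ∈ C, ∀ y ∈ C,
      ‖T x - T y‖ ^ 2 ≤ ‖x - y‖ ^ 2 + k * ‖x - y - T x + T y‖ ^ 2)
    (lam : ℝ) (hlam : lam ∈ Set.Ioo 0 (1 - k)) :
    ∀ x ∈ C, ∀ y ∈ C,
      ‖((1 - lam) • x + lam • T x) - ((1 - lam) • y + lam • T y)‖ ≤ ‖x - y‖ := by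
  intro x hx y hy
  obtain ⟨hpos, hlt⟩ := hlam
  have h := hspc x hx y hy
  set d := x - y - T x + T y with hd
  have hTd : T x - T y = (x - y) - d := by rw [hd]; abel
  have havg : ((1 - lam) • x + lam • T x) - ((1 - lam) • y + lam • T y)
      = (x - y) - lam • d := by
    rw [hd]; module
  rw [hTd, norm_sub_sq_real] at h
  rw [havg]
  refine (sq_le_sq₀ (norm_nonneg _) (norm_nonneg _)).1 ?_
  rw [norm_sub_sq_real, inner_smul_right, norm_smul, mul_pow, Real.norm_eq_abs, sq_abs]
  have hinner : (1 - k) * ‖d‖ ^ 2 ≤ 2 * inner ℝ (x - y) d := by linarith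
  have hscaled := mul_le_mul_of_nonneg_left hinner hpos.le
  have hgap : 0 ≤ lam * (1 - k - lam) * ‖d‖ ^ 2 :=
    mul_nonneg (mul_nonneg hpos.le (by linarith)) (sq_nonneg _)
  nlinarith
end

section
/- There exists a k-demicontractive mapping that is not quasi-nonexpansive; hence the inclusion of the class of quasi-nonexpansive mappings into the class of demicontractive mappings is strict. Concretely, T₅ : [0,1] → [0,1] defined by T₅x = 7/8 for 0 ≤ x < 1 and T₅1 = 1/4 is (2/3)-demicontractive but not quasi-nonexpansive. -/
/-- There is a demicontractive mapping which is not quasi-nonexpansive: `T₅` on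
`[0, 1]` (with `T₅ x = 7/8` for `x < 1`, `T₅ 1 = 1/4`) has `Fix T₅ = {7/8}`, is
`(2/3)`-demicontractive, but is not quasi-nonexpansive. -/
theorem stmt_17 (T : ℝ → ℝ)
    (hT : ∀ x, x < 1 → T x = 7 / 8) (hT1 : T 1 = 1 / 4) :
    ({x ∈ Set.Icc (0 : ℝ) 1 | T x = x} = {7 / 8}) ∧
    (∀ x ∈ Set.Icc (0 : ℝ) 1, ∀ y ∈ Set.Icc (0 : ℝ) 1, T y = y →
      |T x - y| ^ 2 ≤ |x - y| ^ 2 + (2 / 3) * |x - T x| ^ 2) ∧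
    ¬ (∀ x ∈ Set.Icc (0 : ℝ) 1, ∀ y ∈ Set.Icc (0 : ℝ) 1, T y = y →
      |T x - y| ≤ |x - y|) := by
  have fixed_eq : ∀ y ∈ Set.Icc (0 : ℝ) 1, T y = y → y = 7 / 8 := by
    intro y hy hfix
    rcases hy.2.lt_or_eq with h | rfl
    · rw [← hfix, hT y h]
    · norm_num [hT1] at hfix
  have fixed : T (7 / 8) = 7 / 8 := hT _ (by norm_num)
  refine ⟨?_, ?_, ?_⟩
  · ext y
    constructor
    · rintro ⟨hy, hfix⟩
      exact fixed_eq y hy hfix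
    · rintro rfl
      exact ⟨by norm_num, fixed⟩
  · intro x hx y hy hfix
    obtain rfl := fixed_eq y hy hfix
    simp only [sq_abs]
    rcases hx.2.lt_or_eq with h | rfl
    · rw [hT x h]
      nlinarith [sq_nonneg (x - 7 / 8)]
    · norm_num [hT1]
  · intro h
    have h1 := h 1 (by norm_num) (7 / 8) (by norm_num) fixed
    norm_num [hT1, abs_le] at h1
end
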